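/- arXiv:0805.2331 — 4 statements merged into one kernel-verified Lean document; each statement's English description precedes it below -/
import Mathlib

section
/- If H is a finite subgroup of Aut_K K(x), then Fix(H) strictly contains K, the extension Fix(H) ⊆ K(x) is normal, and Fix(H) = K(f) for some rational function f of degree equal to |H|. -/
/-- The degree of a rational function: the maximum of the degrees of its
numerator and denominator (in lowest terms). -/
noncomputable def RatFunc.deg {K : Type*} [Field K] (f : RatFunc K) : ℕ :=
  max f.num.natDegree f.denom.natDegree

/-- For a finite subgroup `H` of `Aut_K K(x)`, the fixed field strictly contains `K`,
the extension `Fix(H) ⊆ K(x)` is normal, and `Fix(H) = K(f)` with `deg f = |H|`. -/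
theorem fixedField_of_finite {K : Type*} [Field K]
    (H : Subgroup (RatFunc K ≃ₐ[K] RatFunc K)) [Finite H] :
    ⊥ < IntermediateField.fixedField H ∧
    Normal (IntermediateField.fixedField H) (RatFunc K) ∧
    ∃ f : RatFunc K, f.deg = Nat.card H ∧
      IntermediateField.fixedField H = IntermediateField.adjoin K {f} := by
  have hfr : Module.finrank (IntermediateField.fixedField H) (RatFunc K) = Nat.card H := by
    cases nonempty_fintype H
    rw [Nat.card_eq_fintype_card]
    exact FixedPoints.finrank_eq_card H (RatFunc K)
  have hn : Normal (IntermediateField.fixedField H) (RatFunc K) :=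
    FixedPoints.normal H (RatFunc K)
  have hfd : FiniteDimensional (IntermediateField.fixedField H) (RatFunc K) :=
    Module.finite_of_finrank_pos (by rw [hfr]; exact Nat.card_pos)
  refine ⟨?_, hn, RatFunc.Luroth.generator (IntermediateField.fixedField H), ?_,
    RatFunc.Luroth.eq_adjoin_generator⟩
  · rw [bot_lt_iff_ne_bot]
    intro h
    have h1 := hfr
    rw [h, IntermediateField.finrank_bot',
      Module.finrank_of_not_finite fun h2 ↦ Algebra.transcendental_iff_not_isAlgebraic.mp
      RatFunc.transcendental <| Algebra.IsAlgebraic.of_finite K (RatFunc K)] at h1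
    exact Nat.card_pos.ne h1
  · rw [RatFunc.deg, ← RatFunc.finrank_eq_max_natDegree, ← RatFunc.Luroth.eq_adjoin_generator, hfr]
end

section
/- If K is an infinite field, then for f ∈ K(x): f is constant (f ∈ K) if and only if the fixing group G_f is infinite. -/
theorem aux_algebraMap_eq_aeval {K : Type*} [Field K] (p : Polynomial K) :
    algebraMap (Polynomial K) (RatFunc K) p = Polynomial.aeval (RatFunc.X : RatFunc K) p := by
  rw [← RatFunc.algebraMap_X, Polynomial.aeval_algebraMap_apply, Polynomial.aeval_X_left_apply]

theorem aux_inj {K : Type*} [Field K] {σ τ : RatFunc K ≃ₐ[K] RatFunc K}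
    (h : σ RatFunc.X = τ RatFunc.X) : σ = τ := by
  ext x
  rw [← RatFunc.num_div_denom x, map_div₀, map_div₀]
  simp only [aux_algebraMap_eq_aeval]
  rw [← Polynomial.aeval_algHom_apply, ← Polynomial.aeval_algHom_apply,
    ← Polynomial.aeval_algHom_apply, ← Polynomial.aeval_algHom_apply, h]

/-- Over an infinite field, `f ∈ K(x)` is constant iff its fixing group is infinite. -/
theorem constant_iff_infinite_fixingGroup {K : Type*} [Field K] [Infinite K]
    (f : RatFunc K) :
    f ∈ Set.range (algebraMap K (RatFunc K)) ↔
      Infinite {σ : RatFunc K ≃ₐ[K] RatFunc K // σ f = f} := by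
  constructor
  · rintro ⟨c, rfl⟩
    refine Infinite.of_injective (β := K) (fun a => ⟨IsFractionRing.fieldEquivOfAlgEquiv K
      (RatFunc K) (RatFunc K) (Polynomial.algEquivAevalXAddC a), AlgEquiv.commutes _ c⟩) ?_
    intro a b h
    have h1 := congrArg (fun s => s.1 (algebraMap (Polynomial K) (RatFunc K) Polynomial.X)) h
    simp only [IsFractionRing.fieldEquivOfAlgEquiv_algebraMap] at h1
    have h2 := IsFractionRing.injective (Polynomial K) (RatFunc K) h1
    simpa using h2
  · intro hinf
    by_contra hf
    let ψ := algebraMap K (RatFunc K)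
    let P : Polynomial (RatFunc K) := f.num.map ψ - Polynomial.C f * f.denom.map ψ
    have hP : P ≠ 0 := by
      intro h0
      have h1 := congrArg (fun q => Polynomial.coeff q f.denom.natDegree) h0
      simp only [P, Polynomial.coeff_sub, Polynomial.coeff_C_mul, Polynomial.coeff_map,
        Polynomial.coeff_zero, (RatFunc.monic_denom f).coeff_natDegree, map_one, mul_one] at h1
      exact hf ⟨_, sub_eq_zero.1 h1⟩
    have hfin : Set.Finite {y | P.IsRoot y} := Polynomial.finite_setOfPred_isRoot hP
    have := hfin.to_subtype
    refine not_finite_iff_infinite.2 hinf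
      (Finite.of_injective (β := {y | P.IsRoot y}) (fun s => ⟨s.1 RatFunc.X, ?_⟩) ?_)
    · obtain ⟨σ, hσ⟩ := s
      have hd : algebraMap (Polynomial K) (RatFunc K) f.denom ≠ 0 :=
        RatFunc.algebraMap_ne_zero f.denom_ne_zero
      have h1 : algebraMap (Polynomial K) (RatFunc K) f.num
          = f * algebraMap (Polynomial K) (RatFunc K) f.denom :=
        (div_eq_iff hd).1 (RatFunc.num_div_denom f)
      have h2 := congrArg σ h1
      rw [map_mul, hσ, aux_algebraMap_eq_aeval, aux_algebraMap_eq_aeval,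
        ← Polynomial.aeval_algHom_apply, ← Polynomial.aeval_algHom_apply] at h2
      simp only [Set.mem_ofPred_eq, Polynomial.IsRoot, P, ψ, Polynomial.eval_sub,
        Polynomial.eval_mul, Polynomial.eval_C, Polynomial.eval_map_algebraMap]
      exact sub_eq_zero.2 h2
    · intro s t h
      exact Subtype.ext (aux_inj (congrArg Subtype.val h))
end

section
/- If f ∈ K(x) is indecomposable of prime degree p, then its fixing group G_f is either cyclic of order p or trivial; if f is indecomposable of non-prime degree, G_f is trivial. -/
/-- Functional composition of rational functions: `g.comp h = g ∘ h = g(h)`. -/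
noncomputable def RatFunc.comp {K : Type*} [Field K] (g h : RatFunc K) : RatFunc K :=
  RatFunc.eval (algebraMap K (RatFunc K)) h g

open IntermediateField in
theorem RatFunc.adjoin_eq_top_of_deg {K : Type*} [Field K] {h : RatFunc K} (hd : h.deg = 1) :
    K⟮h⟯ = ⊤ := by
  have h1 : Module.finrank K⟮h⟯ (RatFunc K) = 1 := by
    rw [RatFunc.finrank_eq_max_natDegree]; exact hd
  exact IntermediateField.finrank_eq_one_iff_eq_top.mp h1

theorem RatFunc.not_const_of_indec {K : Type*} [Field K] (f : RatFunc K)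
    (hind : ∀ g h : RatFunc K, g.comp h = f → g.deg = 1 ∨ h.deg = 1) :
    ¬ ∃ c, f = RatFunc.C c := by
  rintro ⟨c, rfl⟩
  have hX : (RatFunc.X ^ 2 : RatFunc K) = algebraMap (Polynomial K) _ (Polynomial.X ^ 2) := by simp
  rcases hind (RatFunc.C c) (RatFunc.X ^ 2) (by simp [RatFunc.comp, RatFunc.eval_C]) with h | h
  · simp [RatFunc.deg] at h
  · rw [hX, RatFunc.deg, RatFunc.num_algebraMap, RatFunc.denom_algebraMap] at h
    simp at h

open IntermediateField in
theorem RatFunc.eq_of_indec {K : Type*} [Field K] (f : RatFunc K)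
    (hind : ∀ g h : RatFunc K, g.comp h = f → g.deg = 1 ∨ h.deg = 1)
    (E : IntermediateField K (RatFunc K)) (hE : K⟮f⟯ ≤ E) : E = K⟮f⟯ ∨ E = ⊤ := by
  have hf := RatFunc.not_const_of_indec f hind
  have hfE : f ∈ E := adjoin_simple_le_iff.mp hE
  have hbot : E ≠ ⊥ := by
    rintro rfl
    obtain ⟨c, hc⟩ := IntermediateField.mem_bot.mp hfE
    exact hf ⟨c, hc.symm⟩
  let φ := RatFunc.Luroth.algEquiv hbot
  let g := φ.symm ⟨f, hfE⟩
  have hφg : φ g = ⟨f, hfE⟩ := φ.apply_symm_apply _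
  have hcomp : g.comp (RatFunc.Luroth.generator E : RatFunc K) = f := by
    have := congrArg (Subtype.val) hφg
    rw [RatFunc.Luroth.algEquiv_apply] at this
    exact this
  rcases hind _ _ hcomp with h | h
  · left
    have h1 := RatFunc.adjoin_eq_top_of_deg h
    have h2 := congrArg (IntermediateField.map (E.val.comp φ.toAlgHom)) h1
    rw [adjoin_map, Set.image_singleton] at h2
    have h3 : (E.val.comp φ.toAlgHom) g = f := congrArg (Subtype.val) hφg
    rw [h3] at h2
    rw [h2]
    ext x
    constructor
    · intro hx
      exact ⟨φ.symm ⟨x, hx⟩, trivial, congrArg Subtype.val (φ.apply_symm_apply ⟨x, hx⟩)⟩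
    · rintro ⟨y, -, rfl⟩
      exact (φ y).2
  · right
    rw [RatFunc.Luroth.eq_adjoin_generator (E := E)]
    exact RatFunc.adjoin_eq_top_of_deg h

open IntermediateField in
theorem RatFunc.stabilizer_eq {K : Type*} [Field K] (f : RatFunc K) :
    MulAction.stabilizer (RatFunc K ≃ₐ[K] RatFunc K) f = K⟮f⟯.fixingSubgroup := by
  ext σ
  rw [MulAction.mem_stabilizer_iff, IntermediateField.mem_fixingSubgroup_iff]
  constructor
  · intro h
    have : K⟮f⟯ ≤ fixedField (Subgroup.zpowers σ) := by
      rw [adjoin_simple_le_iff, IntermediateField.mem_fixedField_iff]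
      intro τ hτ
      have : Subgroup.zpowers σ ≤ MulAction.stabilizer (RatFunc K ≃ₐ[K] RatFunc K) f := by
        rw [Subgroup.zpowers_le]; exact h
      exact this hτ
    intro x hx
    exact (IntermediateField.mem_fixedField_iff _ _).mp (this hx) σ (Subgroup.mem_zpowers σ)
  · intro h
    exact h f (mem_adjoin_simple_self K f)

/-- Galois theory for extensions without proper intermediate fields. -/
theorem gal_of_no_intermediate {F L : Type*} [Field F] [Field L] [Algebra F L]
    [FiniteDimensional F L] (hs : ∀ E : IntermediateField F L, E = ⊥ ∨ E = ⊤) :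
    (IsCyclic (L ≃ₐ[F] L) ∧ Nat.card (L ≃ₐ[F] L) = Module.finrank F L ∧
      (Module.finrank F L).Prime) ∨ Subsingleton (L ≃ₐ[F] L) := by
  rcases subsingleton_or_nontrivial (L ≃ₐ[F] L) with h | h
  · exact Or.inr h
  left
  have hsub : ∀ H : Subgroup (L ≃ₐ[F] L), H = ⊥ ∨ H = ⊤ := by
    have key : ∀ H : Subgroup (L ≃ₐ[F] L), H ≠ ⊥ → IntermediateField.fixedField H = ⊥ := by
      intro H hH
      refine (hs _).resolve_right fun h => hH ?_
      rw [← IntermediateField.fixingSubgroup_fixedField H, h, IntermediateField.fixingSubgroup_top]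
    intro H
    by_cases hH : H = ⊥
    · exact Or.inl hH
    · right
      rw [← IntermediateField.fixingSubgroup_fixedField H, key H hH, IntermediateField.fixingSubgroup_bot]
  have hcyc : IsCyclic (L ≃ₐ[F] L) := by
    obtain ⟨g, hg⟩ := exists_ne (1 : L ≃ₐ[F] L)
    have := (hsub (Subgroup.zpowers g)).resolve_left (Subgroup.zpowers_ne_bot.2 hg)
    exact ⟨⟨g, (Subgroup.eq_top_iff' _).1 this⟩⟩
  have hcard : Nat.card (L ≃ₐ[F] L) = Module.finrank F L := by
    have hb : IntermediateField.fixedField (⊤ : Subgroup (L ≃ₐ[F] L)) = ⊥ := by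
      refine (hs _).resolve_right fun h => ?_
      have h2 := IntermediateField.fixingSubgroup_fixedField (⊤ : Subgroup (L ≃ₐ[F] L))
      rw [h, IntermediateField.fixingSubgroup_top] at h2
      exact bot_ne_top h2
    have := IntermediateField.finrank_fixedField_eq_card (⊤ : Subgroup (L ≃ₐ[F] L))
    rw [hb, IntermediateField.finrank_bot', Subgroup.card_top] at this
    exact this.symm
  refine ⟨hcyc, hcard, ?_⟩
  rw [← hcard]
  have : IsSimpleGroup (L ≃ₐ[F] L) := ⟨fun H _ => hsub H⟩
  exact Group.is_simple_iff_prime_card.mp this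

/-- For an indecomposable rational function `f`: if `deg f` is a prime `p`, then the
fixing group `G_f` is either cyclic of order `p` or trivial; if `deg f` is not prime,
then `G_f` is trivial. -/
theorem fixingGroup_of_indecomposable {K : Type*} [Field K] (f : RatFunc K)
    (hind : ∀ g h : RatFunc K, g.comp h = f → g.deg = 1 ∨ h.deg = 1) :
    (f.deg.Prime →
      (IsCyclic (MulAction.stabilizer (RatFunc K ≃ₐ[K] RatFunc K) f) ∧
        Nat.card (MulAction.stabilizer (RatFunc K ≃ₐ[K] RatFunc K) f) = f.deg) ∨
      MulAction.stabilizer (RatFunc K ≃ₐ[K] RatFunc K) f = ⊥) ∧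
    (¬ f.deg.Prime → MulAction.stabilizer (RatFunc K ≃ₐ[K] RatFunc K) f = ⊥) := by
  have hf := RatFunc.not_const_of_indec f hind
  have hfin : Module.finrank (IntermediateField.adjoin K {f}) (RatFunc K) = f.deg :=
    RatFunc.finrank_eq_max_natDegree f
  have hpos : f.deg ≠ 0 := fun h0 => hf ((RatFunc.eq_C_iff f).mpr (Nat.max_eq_zero_iff.mp h0))
  have hfd : FiniteDimensional (IntermediateField.adjoin K {f}) (RatFunc K) :=
    Module.finite_of_finrank_pos (by omega)
  rw [RatFunc.stabilizer_eq]
  let e := IntermediateField.fixingSubgroupEquiv (IntermediateField.adjoin K {f})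
  have hmain := gal_of_no_intermediate (F := IntermediateField.adjoin K {f}) (L := RatFunc K) (by
    intro E
    have hle : IntermediateField.adjoin K {f} ≤ E.restrictScalars K := by
      intro x hx
      exact E.algebraMap_mem ⟨x, hx⟩
    rcases RatFunc.eq_of_indec f hind (E.restrictScalars K) hle with h | h
    · left
      rw [eq_bot_iff]
      intro x hx
      have hx' : x ∈ E.restrictScalars K := hx
      rw [h] at hx'
      exact IntermediateField.mem_bot.mpr ⟨⟨x, hx'⟩, rfl⟩
    · right
      exact IntermediateField.restrictScalars_eq_top_iff.mp h)
  rw [hfin] at hmain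
  rcases hmain with ⟨hc, hn, hp⟩ | hs
  · refine ⟨fun _ => Or.inl ⟨?_, ?_⟩, fun h => absurd hp h⟩
    · exact e.isCyclic.mpr hc
    · rw [← hn]; exact Nat.card_congr e.toEquiv
  · have hb : (IntermediateField.adjoin K {f}).fixingSubgroup = ⊥ := by
      have := e.toEquiv.subsingleton
      exact Subgroup.eq_bot_of_subsingleton _
    exact ⟨fun _ => Or.inr hb, fun _ => hb⟩
end

section
/- Let G = {g₁, …, g_m} be a finite subgroup of Aut_K K(x), and P(t) = ∏ᵢ (t − gᵢ(x)) ∈ K(x)[t]. Then any non-constant coefficient c of P(t) (i.e., c ∈ K(x) \ K) generates the fixed field: Fix(G) = K(c). -/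
theorem RF_height_le {K : Type*} [Field K] (f : RatFunc K) (p q : Polynomial K) (hq : q ≠ 0)
    (n : ℕ) (hp : p.natDegree ≤ n) (hqn : q.natDegree ≤ n)
    (h : f = algebraMap _ (RatFunc K) p / algebraMap _ (RatFunc K) q) :
    max f.num.natDegree f.denom.natDegree ≤ n := by
  subst h
  apply max_le
  · by_cases hp0 : p = 0
    · simp [hp0]
    · exact (Polynomial.natDegree_le_of_dvd (RatFunc.num_div_dvd p hq) hp0).trans hp
  · exact (Polynomial.natDegree_le_of_dvd (RatFunc.denom_div_dvd p q) hq).trans hqn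

theorem RF_aut_height {K : Type*} [Field K] (σ : RatFunc K ≃ₐ[K] RatFunc K) :
    max (σ RatFunc.X).num.natDegree (σ RatFunc.X).denom.natDegree = 1 := by
  rw [← RatFunc.finrank_eq_max_natDegree]
  have h : IntermediateField.adjoin K {σ RatFunc.X} = ⊤ := by
    have := IntermediateField.adjoin_map K {(RatFunc.X : RatFunc K)} (σ : RatFunc K →ₐ[K] RatFunc K)
    rw [RatFunc.adjoin_X] at this
    simp only [Set.image_singleton] at this
    refine Eq.trans this.symm ?_
    rw [← AlgHom.fieldRange_eq_map]
    exact AlgHom.fieldRange_eq_top.mpr σ.surjective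
  rw [h]
  exact IntermediateField.finrank_top

theorem RF_coeff_deg {K : Type*} [Field K] {ι : Type*} (s : Finset ι) (d n : ι → Polynomial K)
    (hd : ∀ i, (d i).natDegree ≤ 1) (hn : ∀ i, (n i).natDegree ≤ 1) (k : ℕ) :
    ((∏ i ∈ s, (Polynomial.C (d i) * Polynomial.X - Polynomial.C (n i))).coeff k).natDegree
      ≤ s.card := by
  classical
  induction s using Finset.induction_on generalizing k with
  | empty =>
    rw [Finset.prod_empty, Polynomial.coeff_one]
    split_ifs <;> simp
  | insert a s ha ih =>
    rw [Finset.prod_insert ha, Finset.card_insert_of_notMem ha, sub_mul, Polynomial.coeff_sub,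
      mul_assoc, Polynomial.coeff_C_mul, Polynomial.coeff_C_mul]
    refine (Polynomial.natDegree_sub_le _ _).trans (max_le ?_ ?_)
    · refine Polynomial.natDegree_mul_le.trans ?_
      have : ((Polynomial.X * ∏ i ∈ s, (Polynomial.C (d i) * Polynomial.X
          - Polynomial.C (n i))).coeff k).natDegree ≤ s.card := by
        cases k with
        | zero => simp
        | succ k => rw [Polynomial.coeff_X_mul]; exact ih k
      have := hd a
      omega
    · refine Polynomial.natDegree_mul_le.trans ?_
      have := ih k
      have := hn a
      omega

/-- Let `G` be a finite group of `K`-automorphisms of `K(x)` and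
`P(t) = ∏_{g ∈ G} (t - g(x)) ∈ K(x)[t]`. Then any non-constant coefficient of
`P(t)` generates the fixed field of `G`. -/
theorem fixedField_eq_adjoin_coeff {K : Type*} [Field K]
    (G : Subgroup (RatFunc K ≃ₐ[K] RatFunc K)) [Fintype G] (i : ℕ)
    (hc : (∏ σ : G, (Polynomial.X - Polynomial.C ((σ : RatFunc K ≃ₐ[K] RatFunc K)
        RatFunc.X))).coeff i ∉ Set.range (algebraMap K (RatFunc K))) :
    IntermediateField.fixedField G = IntermediateField.adjoin K
      {(∏ σ : G, (Polynomial.X - Polynomial.C ((σ : RatFunc K ≃ₐ[K] RatFunc K)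
        RatFunc.X))).coeff i} := by
  set P := ∏ σ : G, (Polynomial.X - Polynomial.C ((σ : RatFunc K ≃ₐ[K] RatFunc K)
        RatFunc.X)) with hP
  have hmem : P.coeff i ∈ IntermediateField.fixedField G := by
    rw [IntermediateField.mem_fixedField_iff]
    intro τ hτ
    have h1 : P.map ((τ : RatFunc K ≃ₐ[K] RatFunc K) : RatFunc K →+* RatFunc K) = P := by
      rw [hP, Polynomial.map_prod]
      refine Fintype.prod_equiv (Equiv.mulLeft (⟨τ, hτ⟩ : G)) _ _ ?_
      intro σ
      simp
    have h2 := congrArg (fun p => Polynomial.coeff p i) h1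
    simpa using h2
  let d : G → Polynomial K := fun σ => ((σ : RatFunc K ≃ₐ[K] RatFunc K) RatFunc.X).denom
  let n : G → Polynomial K := fun σ => ((σ : RatFunc K ≃ₐ[K] RatFunc K) RatFunc.X).num
  have hd : ∀ σ, (d σ).natDegree ≤ 1 := fun σ => (le_max_right _ _).trans (RF_aut_height _).le
  have hn : ∀ σ, (n σ).natDegree ≤ 1 := fun σ => (le_max_left _ _).trans (RF_aut_height _).le
  have hd0 : ∀ σ, d σ ≠ 0 := fun σ => RatFunc.denom_ne_zero _
  have hq0 : (∏ σ, d σ) ≠ 0 := Finset.prod_ne_zero_iff.mpr fun σ _ => hd0 σ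
  have hQ : (∏ σ, (Polynomial.C (d σ) * Polynomial.X - Polynomial.C (n σ))).map
      (algebraMap (Polynomial K) (RatFunc K)) =
      Polynomial.C (algebraMap (Polynomial K) (RatFunc K) (∏ σ, d σ)) * P := by
    rw [hP, Polynomial.map_prod, map_prod, map_prod, ← Finset.prod_mul_distrib]
    refine Finset.prod_congr rfl fun σ _ => ?_
    have h0 : algebraMap (Polynomial K) (RatFunc K) (d σ) ≠ 0 :=
      RatFunc.algebraMap_ne_zero (hd0 σ)
    have h1 : algebraMap (Polynomial K) (RatFunc K) (d σ) *
        (σ : RatFunc K ≃ₐ[K] RatFunc K) RatFunc.X = algebraMap _ _ (n σ) := by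
      conv_lhs => rw [← RatFunc.num_div_denom ((σ : RatFunc K ≃ₐ[K] RatFunc K) RatFunc.X)]
      exact mul_div_cancel₀ _ h0
    rw [mul_sub, ← Polynomial.C_mul, h1]
    simp
  have hheight := RF_height_le (P.coeff i)
    ((∏ σ, (Polynomial.C (d σ) * Polynomial.X - Polynomial.C (n σ))).coeff i)
    (∏ σ, d σ) hq0 (Fintype.card G) (RF_coeff_deg Finset.univ d n hd hn i)
    ((Polynomial.natDegree_prod_le _ _).trans
      ((Finset.sum_le_sum fun σ _ => hd σ).trans (by simp)))
    (by
      rw [eq_div_iff (RatFunc.algebraMap_ne_zero hq0), ← Polynomial.coeff_map, hQ,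
        Polynomial.coeff_C_mul, mul_comm])
  have hle : IntermediateField.adjoin K {P.coeff i} ≤ IntermediateField.fixedField G :=
    IntermediateField.adjoin_simple_le_iff.mpr hmem
  have hfix : Module.finrank (IntermediateField.fixedField G) (RatFunc K) = Fintype.card G :=
    FixedPoints.finrank_eq_card G (RatFunc K)
  have hne : ¬ ∃ c, P.coeff i = RatFunc.C c := by
    rintro ⟨c, h⟩
    exact hc ⟨c, by rw [h]; rfl⟩
  have hfin : Module.finrank (IntermediateField.adjoin K {P.coeff i}) (RatFunc K) ≤
      Fintype.card G := by
    rw [RatFunc.finrank_eq_max_natDegree]; exact hheight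
  have hpos : 0 < Module.finrank (IntermediateField.adjoin K {P.coeff i}) (RatFunc K) := by
    rw [RatFunc.finrank_eq_max_natDegree, Nat.pos_iff_ne_zero]
    intro H
    exact hne ((RatFunc.eq_C_iff _).mpr (Nat.max_eq_zero_iff.mp H))
  have : FiniteDimensional (IntermediateField.adjoin K {P.coeff i}) (RatFunc K) :=
    Module.finite_of_finrank_pos hpos
  exact (IntermediateField.eq_of_le_of_finrank_le' hle (hfin.trans hfix.ge)).symm
end
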